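/- N_VI + 4·N_VIII + N_X = 2·N̂_ℍ, i.e. #{χ ∈ Irr(G) : F(χ)=0, F♯(χ)=−1} + 4·#{χ : F(χ)=−1, F♯(χ)=−1} + #{χ : F(χ)=−1, F♯(χ)=0} = 2·#{ψ ∈ Irr(Ĝ) : FŜ(ψ)=−1}. -/

import Mathlib

open scoped Classical

/-- `χ` is the character of an irreducible complex representation of `G`. -/
def IsIrrChar (G : Type) [Group G] (χ : G → ℂ) : Prop :=
  ∃ V : FDRep ℂ G, CategoryTheory.Simple V ∧ χ = V.character

/-- The Frobenius–Schur indicator of a function `χ` on a finite group `G`. -/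
noncomputable def FS (G : Type) [Group G] [Finite G] (χ : G → ℂ) : ℂ :=
  (∑ᶠ g : G, χ (g ^ 2)) / (Nat.card G : ℂ)

theorem conj_mem_of_index_two {Ghat : Type} [Group Ghat] {G : Subgroup Ghat} (h2 : G.index = 2)
    {g : Ghat} (hg : g ∈ G) (x : Ghat) : x * g * x⁻¹ ∈ G := by
  rw [Subgroup.mul_mem_iff_of_index_two h2, Subgroup.mul_mem_iff_of_index_two h2]
  simp [hg, Subgroup.inv_mem_iff]

/-- The twisted Frobenius–Schur indicator, summing over the coset `Ghat \ G`. -/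
noncomputable def FSsharp {Ghat : Type} [Group Ghat] [Finite Ghat] (G : Subgroup Ghat)
    (h2 : G.index = 2) (χ : ↥G → ℂ) : ℂ :=
  (∑ᶠ g ∈ {g : Ghat | g ∉ G}, χ ⟨g ^ 2, Subgroup.sq_mem_of_index_two h2 g⟩) / (Nat.card ↥G : ℂ)

/-- `χ^a`, the complex conjugate character. -/
def aChar {G : Type} [Group G] (χ : G → ℂ) : G → ℂ := fun g => starRingEnd ℂ (χ g)

/-- `χ^b : g ↦ χ(x g x⁻¹)`. -/
def bChar {Ghat : Type} [Group Ghat] {G : Subgroup Ghat} (h2 : G.index = 2) (x : Ghat)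
    (χ : ↥G → ℂ) : ↥G → ℂ :=
  fun g => χ ⟨x * ↑g * x⁻¹, conj_mem_of_index_two h2 g.2 x⟩

/-- `χ^c = conj(χ^b)`. -/
def cChar {Ghat : Type} [Group Ghat] {G : Subgroup Ghat} (h2 : G.index = 2) (x : Ghat)
    (χ : ↥G → ℂ) : ↥G → ℂ := aChar (bChar h2 x χ)

/-- `K` is a conjugacy class of `G`. -/
def IsConjClass (G : Type) [Group G] (K : Set G) : Prop := ∃ g : G, K = {h | IsConj g h}

/-- `K^b = xKx⁻¹`. -/
def bClass {Ghat : Type} [Group Ghat] {G : Subgroup Ghat} (h2 : G.index = 2) (x : Ghat)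
    (K : Set ↥G) : Set ↥G :=
  (fun g : ↥G => (⟨x * ↑g * x⁻¹, conj_mem_of_index_two h2 g.2 x⟩ : ↥G)) '' K


/-! ### Characters of finite-dimensional representations -/

section Characters

variable {G : Type} [Group G]

/-- `χ` is the character of a finite-dimensional complex representation of `G`. -/
def IsRepChar (G : Type) [Group G] (χ : G → ℂ) : Prop :=
  ∃ V : FDRep ℂ G, χ = V.character

/-- The bilinear form `(χ, φ) ↦ |G|⁻¹ ∑ χ(g) φ(g⁻¹)` on functions on `G`. -/
noncomputable def charInner [Fintype G] (χ φ : G → ℂ) : ℂ :=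
  (Nat.card G : ℂ)⁻¹ * ∑ g, χ g * φ g⁻¹

theorem IsIrrChar.isRepChar {χ : G → ℂ} (h : IsIrrChar G χ) : IsRepChar G χ :=
  let ⟨V, _, hV⟩ := h
  ⟨V, hV⟩

theorem Representation.isRepChar_character {V : Type} [AddCommGroup V] [Module ℂ V]
    [FiniteDimensional ℂ V] (ρ : Representation ℂ G V) : IsRepChar G ρ.character :=
  ⟨FDRep.of ρ, rfl⟩

theorem IsRepChar.add {χ φ : G → ℂ} (hχ : IsRepChar G χ) (hφ : IsRepChar G φ) :
    IsRepChar G (χ + φ) := by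
  obtain ⟨V, rfl⟩ := hχ
  obtain ⟨W, rfl⟩ := hφ
  refine ⟨FDRep.of (Representation.prod V.ρ W.ρ), ?_⟩
  ext g
  exact (LinearMap.trace_prodMap' (V.ρ g) (W.ρ g)).symm

theorem isRepChar_zero : IsRepChar G 0 := by
  refine ⟨FDRep.of (1 : Representation ℂ G PUnit), ?_⟩
  ext g
  change 0 = LinearMap.trace ℂ PUnit _
  rw [Subsingleton.elim ((FDRep.of (1 : Representation ℂ G PUnit)).ρ g) 0, map_zero]

theorem IsRepChar.comp {H : Type} [Group H] {χ : G → ℂ} (hχ : IsRepChar G χ) (f : H →* G) :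
    IsRepChar H (χ ∘ f) := by
  obtain ⟨V, rfl⟩ := hχ
  exact ⟨FDRep.of (MonoidHom.comp V.ρ f), rfl⟩

theorem IsRepChar.dual {χ : G → ℂ} (hχ : IsRepChar G χ) : IsRepChar G (fun g => χ g⁻¹) := by
  obtain ⟨V, rfl⟩ := hχ
  exact ⟨FDRep.of (Representation.dual V.ρ), funext fun g => (FDRep.char_dual V g).symm⟩

theorem IsRepChar.conj {χ : G → ℂ} (hχ : IsRepChar G χ) (g h : G) :
    χ (h * g * h⁻¹) = χ g := by
  obtain ⟨V, rfl⟩ := hχ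
  exact V.char_conj g h

theorem IsRepChar.apply_one {χ : G → ℂ} (hχ : IsRepChar G χ) : ∃ n : ℕ, χ 1 = n := by
  obtain ⟨V, rfl⟩ := hχ
  exact ⟨_, V.char_one⟩

theorem IsRepChar.eq_zero_of_apply_one {χ : G → ℂ} (hχ : IsRepChar G χ) (h : χ 1 = 0) :
    χ = 0 := by
  obtain ⟨V, rfl⟩ := hχ
  rw [V.char_one, Nat.cast_eq_zero] at h
  have := Module.finrank_zero_iff.1 h
  ext g
  rw [FDRep.character, Subsingleton.elim (V.ρ g) 0, map_zero, Pi.zero_apply]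

theorem IsRepChar.eq_zero_of_add_eq_zero {χ φ : G → ℂ} (hχ : IsRepChar G χ)
    (hφ : IsRepChar G φ) (h : χ + φ = 0) : χ = 0 := by
  obtain ⟨m, hm⟩ := hχ.apply_one
  obtain ⟨n, hn⟩ := hφ.apply_one
  have h1 := congrFun h 1
  rw [Pi.add_apply, hm, hn, Pi.zero_apply] at h1
  norm_cast at h1
  apply hχ.eq_zero_of_apply_one
  rw [hm]
  norm_cast
  omega

theorem isRepChar_multiset_sum (s : Multiset (G → ℂ)) (hs : ∀ φ ∈ s, IsIrrChar G φ) :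
    IsRepChar G s.sum := by
  induction s using Multiset.induction_on with
  | empty => exact isRepChar_zero
  | cons a s ih =>
    rw [Multiset.sum_cons]
    exact (hs a (by simp)).isRepChar.add (ih fun φ hφ => hs φ (by simp [hφ]))

variable [Fintype G]

theorem charInner_comm (χ φ : G → ℂ) : charInner χ φ = charInner φ χ := by
  unfold charInner
  congr 1
  refine Fintype.sum_equiv (Equiv.inv G) _ _ fun g => ?_
  simp [mul_comm]

theorem charInner_add_left (χ₁ χ₂ φ : G → ℂ) :
    charInner (χ₁ + χ₂) φ = charInner χ₁ φ + charInner χ₂ φ := by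
  simp [charInner, add_mul, Finset.sum_add_distrib, mul_add]

theorem charInner_add_right (χ φ₁ φ₂ : G → ℂ) :
    charInner χ (φ₁ + φ₂) = charInner χ φ₁ + charInner χ φ₂ := by
  simp [charInner, mul_add, Finset.sum_add_distrib]

theorem charInner_zero_left (φ : G → ℂ) : charInner 0 φ = 0 := by
  simp [charInner]

theorem charInner_comp_mulEquiv {H : Type} [Group H] [Fintype H] (e : H ≃* G) (χ φ : G → ℂ) :
    charInner (χ ∘ e) (φ ∘ e) = charInner χ φ := by
  unfold charInner
  rw [Nat.card_congr e.toEquiv]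
  congr 1
  exact Fintype.sum_equiv e.toEquiv _ _ fun g => by simp

theorem charInner_dual (χ φ : G → ℂ) :
    charInner (fun g => χ g⁻¹) (fun g => φ g⁻¹) = charInner χ φ := by
  unfold charInner
  congr 1
  exact Fintype.sum_equiv (Equiv.inv G) _ _ fun g => by simp

theorem IsRepChar.charInner_eq_natCast {χ φ : G → ℂ} (hχ : IsRepChar G χ)
    (hφ : IsRepChar G φ) : ∃ n : ℕ, charInner χ φ = n := by
  obtain ⟨V, rfl⟩ := hχ
  obtain ⟨W, rfl⟩ := hφ
  have := invertibleOfNonzero (NeZero.ne (Nat.card G : ℂ))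
  exact ⟨_, W.scalar_product_char_eq_finrank_equivariant V⟩

theorem isIrrChar_iff {χ : G → ℂ} :
    IsIrrChar G χ ↔ IsRepChar G χ ∧ charInner χ χ = 1 := by
  have h0 : (Nat.card G : ℂ) ≠ 0 := NeZero.ne _
  have key (V : FDRep ℂ G) :
      CategoryTheory.Simple V ↔ charInner V.character V.character = 1 := by
    rw [FDRep.simple_iff_char_is_norm_one, charInner, inv_mul_eq_one₀ h0, eq_comm]
  constructor
  · rintro ⟨V, hV, rfl⟩
    exact ⟨⟨V, rfl⟩, (key V).1 hV⟩
  · rintro ⟨⟨V, rfl⟩, h⟩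
    exact ⟨V, (key V).2 h, rfl⟩

theorem IsIrrChar.charInner_self {χ : G → ℂ} (h : IsIrrChar G χ) : charInner χ χ = 1 :=
  (isIrrChar_iff.1 h).2

theorem IsIrrChar.charInner_eq_zero {χ φ : G → ℂ} (hχ : IsIrrChar G χ) (hφ : IsIrrChar G φ)
    (hne : χ ≠ φ) : charInner χ φ = 0 := by
  obtain ⟨V, _, rfl⟩ := hχ
  obtain ⟨W, _, rfl⟩ := hφ
  have := invertibleOfNonzero (NeZero.ne (Nat.card G : ℂ))
  have := FDRep.char_orthonormal V W
  rw [if_neg] at this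
  · exact this
  · rintro ⟨i⟩
    exact hne (FDRep.char_iso i)

theorem IsIrrChar.comp_mulEquiv {H : Type} [Group H] [Fintype H] {χ : G → ℂ}
    (hχ : IsIrrChar G χ) (e : H ≃* G) : IsIrrChar H (χ ∘ e) :=
  isIrrChar_iff.2 ⟨hχ.isRepChar.comp e.toMonoidHom,
    (charInner_comp_mulEquiv e χ χ).trans hχ.charInner_self⟩

theorem IsIrrChar.dual {χ : G → ℂ} (hχ : IsIrrChar G χ) : IsIrrChar G (fun g => χ g⁻¹) :=
  isIrrChar_iff.2 ⟨hχ.isRepChar.dual, (charInner_dual χ χ).trans hχ.charInner_self⟩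

theorem Representation.isIrrChar_character {V : Type} [AddCommGroup V] [Module ℂ V]
    [FiniteDimensional ℂ V] (ρ : Representation ℂ G V) [ρ.IsIrreducible] :
    IsIrrChar G ρ.character := by
  refine isIrrChar_iff.2 ⟨ρ.isRepChar_character, ?_⟩
  have := invertibleOfNonzero (NeZero.ne (Nat.card G : ℂ))
  have := Representation.char_orthonormal ρ ρ
  rwa [if_pos ⟨Representation.Equiv.refl ρ⟩] at this

theorem finite_setOf_isIrrChar : {χ : G → ℂ | IsIrrChar G χ}.Finite := by
  have hli : LinearIndependent ℂ (fun χ : {χ : G → ℂ // IsIrrChar G χ} => χ.1) := by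
    rw [linearIndependent_iff']
    intro s c hc χ hχ
    have h1 : ∑ φ ∈ s, c φ * charInner φ.1 χ.1 = 0 := by
      have h2 : ∀ g, ∑ φ ∈ s, c φ * φ.1 g = 0 := fun g => by
        simpa using congrFun hc g
      simp only [charInner, Finset.mul_sum]
      rw [Finset.sum_comm]
      refine Finset.sum_eq_zero fun g _ => ?_
      calc _ = (Nat.card G : ℂ)⁻¹ * χ.1 g⁻¹ * ∑ φ ∈ s, c φ * φ.1 g := by
            rw [Finset.mul_sum]
            exact Finset.sum_congr rfl fun φ _ => by ring
        _ = 0 := by rw [h2, mul_zero]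
    rw [Finset.sum_eq_single_of_mem χ hχ fun φ _ hne => by
      rw [φ.2.charInner_eq_zero χ.2 fun h => hne (Subtype.ext h), mul_zero],
      χ.2.charInner_self, mul_one] at h1
    exact h1
  exact Set.finite_coe_iff.1 hli.finite

/-- The trace of an operator preserving two complementary subspaces. -/
theorem LinearMap.trace_eq_add_of_isCompl {V : Type*} [AddCommGroup V] [Module ℂ V]
    [FiniteDimensional ℂ V] {p q : Submodule ℂ V} (h : IsCompl p q) (f : V →ₗ[ℂ] V)
    (hp : ∀ v ∈ p, f v ∈ p) (hq : ∀ v ∈ q, f v ∈ q) :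
    LinearMap.trace ℂ V f =
      LinearMap.trace ℂ p (f.restrict hp) + LinearMap.trace ℂ q (f.restrict hq) := by
  rw [← LinearMap.trace_prodMap',
    ← LinearMap.trace_conj' _ (Submodule.prodEquivOfIsCompl p q h)]
  congr 1
  ext v
  obtain ⟨w, rfl⟩ := (Submodule.prodEquivOfIsCompl p q h).surjective v
  simp [LinearEquiv.conj_apply]

/-- Complete reducibility at the level of characters. -/
theorem Representation.character_eq_sum_irr (n : ℕ) :
    ∀ {V : Type} [AddCommGroup V] [Module ℂ V] [FiniteDimensional ℂ V]
      (ρ : Representation ℂ G V), Module.finrank ℂ V = n →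
      ∃ s : Multiset (G → ℂ), (∀ χ ∈ s, IsIrrChar G χ) ∧ ρ.character = s.sum := by
  induction n using Nat.strong_induction_on with
  | _ n ih =>
    intro V _ _ _ ρ hn
    by_cases hirr : ρ.IsIrreducible
    · exact ⟨{ρ.character}, by simpa using ρ.isIrrChar_character, by simp⟩
    rcases subsingleton_or_nontrivial V with hV | hV
    · refine ⟨0, by simp, ?_⟩
      ext g
      rw [Representation.character, Subsingleton.elim (ρ g) 0, map_zero]
      rfl
    obtain ⟨W, hbot, htop⟩ : ∃ W : Subrepresentation ρ, W ≠ ⊥ ∧ W ≠ ⊤ := by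
      by_contra! hcon
      have : Nontrivial (Subrepresentation ρ) := by
        refine ⟨⊥, ⊤, fun h => ?_⟩
        exact bot_ne_top (congrArg Subrepresentation.toSubmodule h)
      exact hirr ⟨fun W => or_iff_not_imp_left.2 (hcon W)⟩
    obtain ⟨W', hc⟩ := exists_isCompl W
    have hc' : IsCompl W.toSubmodule W'.toSubmodule := by
      constructor
      · exact disjoint_iff.2 (congrArg Subrepresentation.toSubmodule hc.inf_eq_bot)
      · exact codisjoint_iff.2 (congrArg Subrepresentation.toSubmodule hc.sup_eq_top)
    have hsum := Submodule.finrank_add_eq_of_isCompl hc'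
    have hW : Module.finrank ℂ W.toSubmodule ≠ 0 := fun h =>
      hbot (Subrepresentation.toSubmodule_injective (Submodule.finrank_eq_zero.1 h))
    have hW' : Module.finrank ℂ W'.toSubmodule ≠ 0 := fun h => by
      have h' : W' = ⊥ := Subrepresentation.toSubmodule_injective (Submodule.finrank_eq_zero.1 h)
      exact htop (by simpa [h'] using hc.sup_eq_top)
    obtain ⟨s, hs, hs'⟩ := ih _ (by omega) W.toRepresentation rfl
    obtain ⟨s', ht, ht'⟩ := ih _ (by omega) W'.toRepresentation rfl
    refine ⟨s + s', ?_, ?_⟩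
    · intro χ hχ
      rcases Multiset.mem_add.1 hχ with h | h
      exacts [hs χ h, ht χ h]
    · rw [Multiset.sum_add, ← hs', ← ht']
      ext g
      exact LinearMap.trace_eq_add_of_isCompl hc' (ρ g) (W.apply_mem_toSubmodule g)
        (W'.apply_mem_toSubmodule g)

theorem IsRepChar.exists_multiset {χ : G → ℂ} (hχ : IsRepChar G χ) :
    ∃ s : Multiset (G → ℂ), (∀ φ ∈ s, IsIrrChar G φ) ∧ χ = s.sum := by
  obtain ⟨V, rfl⟩ := hχ
  exact Representation.character_eq_sum_irr _ (V := V) V.ρ rfl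

theorem IsRepChar.exists_eq_irr_add {χ : G → ℂ} (hχ : IsRepChar G χ) (h : χ ≠ 0) :
    ∃ φ θ, IsIrrChar G φ ∧ IsRepChar G θ ∧ χ = φ + θ := by
  obtain ⟨s, hs, rfl⟩ := hχ.exists_multiset
  obtain ⟨φ, hφ⟩ := Multiset.exists_mem_of_ne_zero (s := s) (by rintro rfl; simp at h)
  obtain ⟨u, rfl⟩ := Multiset.exists_cons_of_mem hφ
  exact ⟨φ, u.sum, hs φ hφ, isRepChar_multiset_sum u fun ψ hψ => hs ψ (by simp [hψ]),
    Multiset.sum_cons _ _⟩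

theorem IsRepChar.exists_eq_add_of_charInner_ne_zero {χ φ : G → ℂ} (hχ : IsRepChar G χ)
    (hφ : IsIrrChar G φ) (h : charInner χ φ ≠ 0) : ∃ θ, IsRepChar G θ ∧ χ = φ + θ := by
  obtain ⟨s, hs, rfl⟩ := hχ.exists_multiset
  have hmem : φ ∈ s := by
    by_contra hmem
    apply h
    clear h hχ
    induction s using Multiset.induction_on with
    | empty => exact charInner_zero_left φ
    | cons a s ih =>
      rw [Multiset.mem_cons, not_or] at hmem
      rw [Multiset.sum_cons, charInner_add_left, ih (fun ψ hψ => hs ψ (by simp [hψ])) hmem.2,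
        (hs a (by simp)).charInner_eq_zero hφ (Ne.symm hmem.1), add_zero]
  obtain ⟨u, rfl⟩ := Multiset.exists_cons_of_mem hmem
  exact ⟨u.sum, isRepChar_multiset_sum u fun ψ hψ => hs ψ (by simp [hψ]),
    Multiset.sum_cons _ _⟩

theorem IsIrrChar.ne_zero {χ : G → ℂ} (hχ : IsIrrChar G χ) : χ ≠ 0 := by
  rintro rfl
  simpa [charInner_zero_left] using hχ.charInner_self

theorem IsIrrChar.eq_of_charInner_ne_zero {χ φ : G → ℂ} (hχ : IsIrrChar G χ)
    (hφ : IsIrrChar G φ) (h : charInner χ φ ≠ 0) : χ = φ :=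
  not_imp_comm.1 (hχ.charInner_eq_zero hφ) h

end Characters

/-! ### Twisted Frobenius–Schur indicators -/

section Twisted

open scoped TensorProduct

theorem LinearMap.trace_comm_comp_map {V : Type*} [AddCommGroup V] [Module ℂ V]
    [FiniteDimensional ℂ V] (a b : V →ₗ[ℂ] V) :
    LinearMap.trace ℂ (V ⊗[ℂ] V)
        ((TensorProduct.comm ℂ V V).toLinearMap ∘ₗ TensorProduct.map a b) =
      LinearMap.trace ℂ V (a ∘ₗ b) := by
  let e := Module.finBasis ℂ V
  rw [LinearMap.trace_eq_matrix_trace ℂ (e.tensorProduct e), LinearMap.trace_eq_matrix_trace ℂ e,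
    LinearMap.toMatrix_comp e e e]
  simp only [Matrix.trace, Matrix.diag, Matrix.mul_apply, Fintype.sum_prod_type,
    LinearMap.toMatrix_apply, LinearMap.comp_apply, Module.Basis.tensorProduct_apply,
    TensorProduct.map_tmul, LinearEquiv.coe_coe, TensorProduct.comm_tmul,
    Module.Basis.tensorProduct_repr_tmul_apply]
  rw [Finset.sum_comm]
  refine Finset.sum_congr rfl fun i _ => Finset.sum_congr rfl fun j _ => ?_
  simp

variable {G : Type} [Group G] [Fintype G]

/-- If the form `|G|⁻¹ ∑ χ(σ g) χ(g)` vanishes, so does the twisted indicator; if it equals one, the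
twisted indicator is a sign. -/
theorem Representation.twisted_indicator {V : Type} [AddCommGroup V] [Module ℂ V]
    [FiniteDimensional ℂ V] (ρ : Representation ℂ G V) (σ : G →* G) (z : G)
    (hσ : ∀ g, σ (σ g) = z * g * z⁻¹) (hz : σ z = z) :
    ((Nat.card G : ℂ)⁻¹ * ∑ g, ρ.character (σ g) * ρ.character g = 0 →
      (Nat.card G : ℂ)⁻¹ * ∑ g, ρ.character (σ g * z * g) = 0) ∧
    ((Nat.card G : ℂ)⁻¹ * ∑ g, ρ.character (σ g) * ρ.character g = 1 →
      (Nat.card G : ℂ)⁻¹ * ∑ g, ρ.character (σ g * z * g) = 1 ∨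
      (Nat.card G : ℂ)⁻¹ * ∑ g, ρ.character (σ g * z * g) = -1) := by
  have := invertibleOfNonzero (NeZero.ne (Nat.card G : ℂ))
  have : Invertible (Fintype.card G : ℂ) := by rwa [Fintype.card_eq_nat_card]
  let T : Representation ℂ G (V ⊗[ℂ] V) := Representation.tprod (ρ.comp σ) ρ
  let A : V ⊗[ℂ] V →ₗ[ℂ] V ⊗[ℂ] V :=
    (_root_.TensorProduct.comm ℂ V V).toLinearMap ∘ₗ _root_.TensorProduct.map LinearMap.id (ρ z)
  let P := T.averageMap
  have hP : P = (Nat.card G : ℂ)⁻¹ • ∑ g, T g := by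
    simp [P, GroupAlgebra.average, map_sum]
  have hT (g : G) (u w : V) : T g (u ⊗ₜ w) = ρ (σ g) u ⊗ₜ ρ g w := rfl
  have hA (u w : V) : A (u ⊗ₜ w) = ρ z w ⊗ₜ u := rfl
  have hcomm (g : G) : T g ∘ₗ A = A ∘ₗ T (z⁻¹ * σ g * z) := by
    refine _root_.TensorProduct.ext' fun u w => ?_
    simp only [LinearMap.comp_apply, hA, hT, ← Module.End.mul_apply, ← map_mul]
    have e1 : σ (z⁻¹ * σ g * z) = g := by
      rw [map_mul, map_mul, map_inv, hσ, hz]; group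
    have e2 : z * (z⁻¹ * σ g * z) = σ g * z := by group
    rw [e1, e2]
  have hsq : A ∘ₗ A = T z := by
    refine _root_.TensorProduct.ext' fun u w => ?_
    simp only [LinearMap.comp_apply, hA, hT, hz]
  have hrank : (Nat.card G : ℂ)⁻¹ * ∑ g, ρ.character (σ g) * ρ.character g =
      Module.finrank ℂ T.invariants := by
    rw [← T.card_inv_mul_sum_char_eq_finrank]
    congr 2
    ext g
    exact (LinearMap.trace_tensorProduct' (ρ (σ g)) (ρ g)).symm
  have hind : (Nat.card G : ℂ)⁻¹ * ∑ g, ρ.character (σ g * z * g) =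
      LinearMap.trace ℂ _ (A ∘ₗ P) := by
    have h1 (g : G) : ρ.character (σ g * z * g) = LinearMap.trace ℂ _ (A ∘ₗ T g) := by
      have h2 : A ∘ₗ T g = (_root_.TensorProduct.comm ℂ V V).toLinearMap ∘ₗ
          _root_.TensorProduct.map (ρ (σ g)) (ρ z ∘ₗ ρ g) :=
        _root_.TensorProduct.ext' fun u w => rfl
      rw [h2, LinearMap.trace_comm_comp_map, Representation.character,
        ρ.map_mul, ρ.map_mul, mul_assoc]
      rfl
    have hs : A * ∑ g, T g = ∑ g, A * T g := Finset.mul_sum _ _ _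
    rw [hP, LinearMap.comp_smul, map_smul, smul_eq_mul, ← Module.End.mul_eq_comp, hs, map_sum]
    simp only [h1, Module.End.mul_eq_comp]
  rw [hrank, hind]
  constructor
  · intro h
    have h0 : T.invariants = ⊥ := Submodule.finrank_eq_zero.1 (by exact_mod_cast h)
    have hP0 : P = 0 := by
      refine LinearMap.ext fun x => ?_
      have h1 := T.averageMap_invariant x
      rw [h0] at h1
      exact (Submodule.mem_bot ℂ).1 h1
    rw [hP0, LinearMap.comp_zero, map_zero]
  · intro h
    have h1 : Module.finrank ℂ T.invariants = 1 := by exact_mod_cast h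
    obtain ⟨⟨v, hv⟩, hv0, hspan⟩ := finrank_eq_one_iff'.1 h1
    have hv0' : v ≠ 0 := fun h => hv0 (Subtype.ext h)
    have hAv : A v ∈ T.invariants := fun g => by
      rw [← LinearMap.comp_apply, hcomm, LinearMap.comp_apply, hv]
    obtain ⟨c, hc⟩ := hspan ⟨A v, hAv⟩
    have hc : A v = c • v := (congrArg Subtype.val hc).symm
    have hcc : c * c = 1 := by
      have h2 : A (A v) = v := by rw [← LinearMap.comp_apply, hsq, hv]
      rw [hc, map_smul, hc, smul_smul] at h2
      exact smul_left_injective ℂ hv0' (by simpa using h2)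
    have hAP : A ∘ₗ P = c • P := by
      refine LinearMap.ext fun x => ?_
      obtain ⟨d, hd⟩ := hspan ⟨P x, T.averageMap_invariant x⟩
      have hd : P x = d • v := (congrArg Subtype.val hd).symm
      rw [LinearMap.comp_apply, LinearMap.smul_apply, hd, map_smul, hc, smul_comm]
    have htr : LinearMap.trace ℂ _ P = 1 := by
      rw [T.isProj_averageMap.trace, h1, Nat.cast_one]
    rw [hAP, map_smul, htr, smul_eq_mul, mul_one]
    exact mul_self_eq_one_iff.1 hcc

/-- The twisted indicator of an irreducible character `χ` is a sign or zero according to whether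
`χ ∘ σ` is the dual of `χ` or not. -/
theorem IsIrrChar.twisted_indicator {χ : G → ℂ} (hχ : IsIrrChar G χ) (σ : G ≃* G) (z : G)
    (hσ : ∀ g, σ (σ g) = z * g * z⁻¹) (hz : σ z = z) :
    (χ ∘ σ ≠ (fun g => χ g⁻¹) → (Nat.card G : ℂ)⁻¹ * ∑ g, χ (σ g * z * g) = 0) ∧
    (χ ∘ σ = (fun g => χ g⁻¹) → (Nat.card G : ℂ)⁻¹ * ∑ g, χ (σ g * z * g) = 1 ∨
      (Nat.card G : ℂ)⁻¹ * ∑ g, χ (σ g * z * g) = -1) := by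
  have hinner : (Nat.card G : ℂ)⁻¹ * ∑ g, χ (σ g) * χ g =
      charInner (χ ∘ σ) (fun g => χ g⁻¹) := by
    simp [charInner]
  have h1 := (hχ.comp_mulEquiv σ).charInner_eq_zero hχ.dual
  have h2 : χ ∘ σ = (fun g => χ g⁻¹) → charInner (χ ∘ σ) (fun g => χ g⁻¹) = 1 := fun h => by
    rw [h]
    exact hχ.dual.charInner_self
  rw [← hinner] at h1 h2
  obtain ⟨V, _, rfl⟩ := hχ
  obtain ⟨h3, h4⟩ := Representation.twisted_indicator (V := V) V.ρ σ.toMonoidHom z hσ hz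
  exact ⟨fun h => h3 (h1 h), fun h => h4 (h2 h)⟩

end Twisted

/-! ### Subgroups of index two -/

section IndexTwo

variable {Ghat : Type} [Group Ghat] {G : Subgroup Ghat}

/-- Extension by zero of a function on a subgroup. -/
noncomputable def extendZero {M : Type} [Zero M] (χ : G → M) (x : Ghat) : M :=
  if h : x ∈ G then χ ⟨x, h⟩ else 0

theorem extendZero_of_mem {M : Type} [Zero M] (χ : G → M) {x : Ghat} (h : x ∈ G) :
    extendZero χ x = χ ⟨x, h⟩ := dif_pos h

theorem extendZero_of_notMem {M : Type} [Zero M] (χ : G → M) {x : Ghat} (h : x ∉ G) :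
    extendZero χ x = 0 := dif_neg h

/-- The function on `Ghat` induced from `χ`, where `t` represents the nontrivial coset of the
subgroup `G` of index two. -/
noncomputable def indChar (t : Ghat) (χ : G → ℂ) (x : Ghat) : ℂ :=
  extendZero χ x + extendZero χ (t * x * t⁻¹)

theorem bChar_eq_comp (h2 : G.index = 2) (t : Ghat) (χ : G → ℂ) :
    haveI := Subgroup.normal_of_index_eq_two h2
    bChar h2 t χ = χ ∘ MulAut.conjNormal t := rfl

theorem indChar_of_notMem (h2 : G.index = 2) (t : Ghat) (χ : G → ℂ) {x : Ghat} (hx : x ∉ G) :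
    indChar t χ x = 0 := by
  have := Subgroup.normal_of_index_eq_two h2
  rw [indChar, extendZero_of_notMem _ hx, extendZero_of_notMem, add_zero]
  rwa [← Subgroup.Normal.mem_comm_iff this, inv_mul_cancel_left]

theorem indChar_comp_subtype (h2 : G.index = 2) (t : Ghat) (χ : G → ℂ) :
    indChar t χ ∘ G.subtype = χ + bChar h2 t χ := by
  funext g
  simp only [Function.comp_apply, indChar, Pi.add_apply, Subgroup.coe_subtype]
  rw [extendZero_of_mem _ g.2, extendZero_of_mem _ (conj_mem_of_index_two h2 g.2 t)]
  rfl

theorem indChar_eq_of_comp_subtype (h2 : G.index = 2) {t : Ghat} {χ : G → ℂ} {ψ : Ghat → ℂ}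
    (hmem : ψ ∘ G.subtype = χ + bChar h2 t χ) (hnot : ∀ x ∉ G, ψ x = 0) : indChar t χ = ψ := by
  funext x
  by_cases hx : x ∈ G
  · exact congrFun ((indChar_comp_subtype h2 t χ).trans hmem.symm) ⟨x, hx⟩
  · rw [indChar_of_notMem h2 t χ hx, hnot x hx]

theorem extendZero_mul {V : Type} [AddCommGroup V] [Module ℂ V] (h2 : G.index = 2) {t : Ghat}
    (ht : t ∉ G) (ρ : Representation ℂ G V) (x y : Ghat) :
    extendZero ρ (x * y) =
      extendZero ρ x * extendZero ρ y + extendZero ρ (x * t⁻¹) * extendZero ρ (t * y) := by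
  have hmul (a b : Ghat) : a * b ∈ G ↔ (a ∈ G ↔ b ∈ G) := Subgroup.mul_mem_iff_of_index_two h2
  by_cases hx : x ∈ G <;> by_cases hy : y ∈ G <;>
    simp [extendZero, hmul, hx, hy, ht, ← map_mul]

/-- The representation induced from a subgroup of index two. -/
noncomputable def indRep {V : Type} [AddCommGroup V] [Module ℂ V] (h2 : G.index = 2) {t : Ghat}
    (ht : t ∉ G) (ρ : Representation ℂ G V) : Representation ℂ Ghat (V × V) where
  toFun x :=
    ((extendZero ρ x).comp (LinearMap.fst ℂ V V)).prod
      ((extendZero ρ (t * x * t⁻¹)).comp (LinearMap.snd ℂ V V)) +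
    ((extendZero ρ (x * t⁻¹)).comp (LinearMap.snd ℂ V V)).prod
      ((extendZero ρ (t * x)).comp (LinearMap.fst ℂ V V))
  map_one' := by
    have h1 : extendZero ρ 1 = 1 := (extendZero_of_mem _ G.one_mem).trans ρ.map_one
    have h3 : extendZero ρ t⁻¹ = 0 := extendZero_of_notMem _ (by simpa using ht)
    refine LinearMap.ext fun v => ?_
    simp [h1, h3, extendZero_of_notMem ρ ht]
  map_mul' x y := by
    refine LinearMap.ext fun v => ?_
    have e (a b : Ghat) (w : V) : extendZero ρ (a * b) w = extendZero ρ a (extendZero ρ b w) +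
        extendZero ρ (a * t⁻¹) (extendZero ρ (t * b) w) := by
      rw [extendZero_mul h2 ht]; rfl
    have e1 := e x y v.1
    have e2 := e x (y * t⁻¹) v.2
    have e3 := e (t * x) y v.1
    have e4 := e (t * x) (y * t⁻¹) v.2
    simp only [← mul_assoc] at e1 e2 e3 e4
    refine Prod.ext ?_ ?_
    · simp [← mul_assoc, e1, e2]; abel
    · simp [← mul_assoc, e3, e4]; abel

theorem character_indRep {V : Type} [AddCommGroup V] [Module ℂ V] [FiniteDimensional ℂ V]
    (h2 : G.index = 2) {t : Ghat} (ht : t ∉ G) (ρ : Representation ℂ G V) :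
    (indRep h2 ht ρ).character = indChar t ρ.character := by
  have htr (x : Ghat) :
      LinearMap.trace ℂ V (extendZero ρ x) = extendZero ρ.character x := by
    by_cases hx : x ∈ G
    · rw [extendZero_of_mem _ hx, extendZero_of_mem _ hx]; rfl
    · rw [extendZero_of_notMem _ hx, extendZero_of_notMem _ hx, map_zero]
  funext x
  rw [indChar, ← htr, ← htr, ← LinearMap.trace_prodMap']
  change LinearMap.trace ℂ (V × V) (_ + _) = _
  rw [map_add]
  have h0 : LinearMap.trace ℂ (V × V)
      (((extendZero ρ (x * t⁻¹)).comp (LinearMap.snd ℂ V V)).prod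
        ((extendZero ρ (t * x)).comp (LinearMap.fst ℂ V V))) = 0 := by
    have h1 : (((extendZero ρ (x * t⁻¹)).comp (LinearMap.snd ℂ V V)).prod
        ((extendZero ρ (t * x)).comp (LinearMap.fst ℂ V V))) =
        LinearMap.inl ℂ V V ∘ₗ (extendZero ρ (x * t⁻¹) ∘ₗ LinearMap.snd ℂ V V) +
        LinearMap.inr ℂ V V ∘ₗ (extendZero ρ (t * x) ∘ₗ LinearMap.fst ℂ V V) :=
      LinearMap.ext fun v => by simp
    rw [h1, map_add, LinearMap.trace_comp_comm' _ (LinearMap.inl ℂ V V),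
      LinearMap.trace_comp_comm' _ (LinearMap.inr ℂ V V), LinearMap.comp_assoc,
      LinearMap.comp_assoc, LinearMap.snd_comp_inl, LinearMap.fst_comp_inr]
    simp
  rw [h0, add_zero]
  rfl

theorem IsRepChar.indChar {χ : G → ℂ} (hχ : IsRepChar G χ) (h2 : G.index = 2) {t : Ghat}
    (ht : t ∉ G) : IsRepChar Ghat (indChar t χ) := by
  obtain ⟨V, rfl⟩ := hχ
  have := (indRep (V := V) h2 ht V.ρ).isRepChar_character
  rwa [character_indRep] at this

theorem IsRepChar.bChar_comp_subtype {ψ : Ghat → ℂ} (hψ : IsRepChar Ghat ψ)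
    (h2 : G.index = 2) (t : Ghat) : bChar h2 t (ψ ∘ G.subtype) = ψ ∘ G.subtype :=
  funext fun g => hψ.conj g.1 t

theorem IsRepChar.bChar_bChar {χ : G → ℂ} (hχ : IsRepChar G χ) (h2 : G.index = 2) (t : Ghat) :
    bChar h2 t (bChar h2 t χ) = χ := by
  funext g
  rw [← hχ.conj g ⟨t ^ 2, Subgroup.sq_mem_of_index_two h2 t⟩]
  refine congrArg χ (Subtype.ext ?_)
  simp only [Subgroup.coe_mul, Subgroup.coe_inv, pow_two, mul_inv_rev, mul_assoc]

theorem IsRepChar.indChar_bChar {χ : G → ℂ} (hχ : IsRepChar G χ) (h2 : G.index = 2)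
    (t : Ghat) : _root_.indChar t (bChar h2 t χ) = _root_.indChar t χ :=
  indChar_eq_of_comp_subtype h2
    (by rw [indChar_comp_subtype h2, hχ.bChar_bChar, add_comm])
    fun _ hx => indChar_of_notMem h2 t χ hx

theorem card_eq_two_mul_of_index_two (h2 : G.index = 2) :
    (Nat.card Ghat : ℂ) = 2 * Nat.card G := by
  rw [← G.card_mul_index, h2]
  push_cast
  ring

variable [Fintype G]

theorem charInner_bChar (h2 : G.index = 2) (t : Ghat) (χ φ : G → ℂ) :
    charInner (bChar h2 t χ) (bChar h2 t φ) = charInner χ φ := by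
  have := Subgroup.normal_of_index_eq_two h2
  exact charInner_comp_mulEquiv (MulAut.conjNormal t) χ φ

theorem IsIrrChar.bChar {χ : G → ℂ} (hχ : IsIrrChar G χ) (h2 : G.index = 2) (t : Ghat) :
    IsIrrChar G (bChar h2 t χ) := by
  have := Subgroup.normal_of_index_eq_two h2
  exact hχ.comp_mulEquiv (MulAut.conjNormal t)

variable [Fintype Ghat]

theorem sum_eq_sum_add_sum_of_index_two (h2 : G.index = 2) {t : Ghat} (ht : t ∉ G)
    (F : Ghat → ℂ) : ∑ x, F x = ∑ g : G, F g + ∑ g : G, F (t * g) := by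
  rw [← Fintype.sum_subtype_add_sum_subtype (· ∈ G) F]
  congr 1
  · exact Finset.sum_congr (by ext; simp) fun _ _ => rfl
  · symm
    have hmul (a b : Ghat) : a * b ∈ G ↔ (a ∈ G ↔ b ∈ G) := Subgroup.mul_mem_iff_of_index_two h2
    refine Fintype.sum_equiv
      { toFun := fun g : G => (⟨t * g, by simp [hmul, ht]⟩ : {x // x ∉ G})
        invFun := fun x => ⟨t⁻¹ * x, by simp [hmul, ht, x.2]⟩
        left_inv := fun g => by simp
        right_inv := fun x => by simp } _ _ fun g => rfl

theorem charInner_eq_half_of_notMem (h2 : G.index = 2) {t : Ghat} (ht : t ∉ G) (ψ : Ghat → ℂ)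
    {φ : Ghat → ℂ} (hφ : ∀ x ∉ G, φ x = 0) :
    charInner ψ φ = 2⁻¹ * charInner (ψ ∘ G.subtype) (φ ∘ G.subtype) := by
  have h0 (g : G) : φ (t * g)⁻¹ = 0 := hφ _ fun h => ht <| by
    rw [Subgroup.inv_mem_iff] at h
    exact (Subgroup.mul_mem_cancel_right G g.2).1 h
  rw [charInner, charInner, sum_eq_sum_add_sum_of_index_two h2 ht, card_eq_two_mul_of_index_two h2]
  simp only [h0, mul_zero, Finset.sum_const_zero, add_zero]
  rw [mul_inv, mul_assoc]
  rfl

/-- Frobenius reciprocity. -/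
theorem IsRepChar.charInner_indChar {ψ : Ghat → ℂ} (hψ : IsRepChar Ghat ψ) (h2 : G.index = 2)
    {t : Ghat} (ht : t ∉ G) (χ : G → ℂ) :
    charInner ψ (_root_.indChar t χ) = charInner (ψ ∘ G.subtype) χ := by
  rw [charInner_eq_half_of_notMem h2 ht ψ fun x hx => indChar_of_notMem h2 t χ hx,
    indChar_comp_subtype h2, charInner_add_right]
  have h := charInner_bChar h2 t (ψ ∘ G.subtype) χ
  rw [hψ.bChar_comp_subtype] at h
  rw [h]
  ring

theorem IsIrrChar.isIrrChar_indChar {χ : G → ℂ} (hχ : IsIrrChar G χ) (h2 : G.index = 2)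
    {t : Ghat} (ht : t ∉ G) (hne : _root_.bChar h2 t χ ≠ χ) : IsIrrChar Ghat (indChar t χ) := by
  have hI := hχ.isRepChar.indChar h2 ht
  refine isIrrChar_iff.2 ⟨hI, ?_⟩
  rw [hI.charInner_indChar h2 ht, indChar_comp_subtype h2, charInner_add_left,
    hχ.charInner_self, (hχ.bChar h2 t).charInner_eq_zero hχ hne, add_zero]

/-- An invariant irreducible character has exactly two extensions. -/
theorem IsIrrChar.exists_extensions {χ : G → ℂ} (hχ : IsIrrChar G χ) (h2 : G.index = 2)
    {t : Ghat} (ht : t ∉ G) (hb : _root_.bChar h2 t χ = χ) :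
    ∃ ψ₁ ψ₂, ψ₁ ≠ ψ₂ ∧ IsIrrChar Ghat ψ₁ ∧ IsIrrChar Ghat ψ₂ ∧ ψ₁ ∘ G.subtype = χ ∧
      ψ₂ ∘ G.subtype = χ ∧ indChar t χ = ψ₁ + ψ₂ := by
  have hI := hχ.isRepChar.indChar h2 ht
  have hres : indChar t χ ∘ G.subtype = χ + χ := by rw [indChar_comp_subtype h2, hb]
  have hne : indChar t χ ≠ 0 := by
    intro h0
    rw [h0] at hres
    exact hχ.ne_zero (hχ.isRepChar.eq_zero_of_add_eq_zero hχ.isRepChar hres.symm)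
  have hII : charInner (indChar t χ) (indChar t χ) = 2 := by
    rw [hI.charInner_indChar h2 ht, hres, charInner_add_left, hχ.charInner_self]
    norm_num
  obtain ⟨ψ, θ, hψ, hθ, hsum⟩ := hI.exists_eq_irr_add hne
  have hψr : IsRepChar G (ψ ∘ G.subtype) := hψ.isRepChar.comp G.subtype
  have hθr : IsRepChar G (θ ∘ G.subtype) := hθ.comp G.subtype
  have hres' : ψ ∘ G.subtype + θ ∘ G.subtype = χ + χ := by
    rw [← hres, hsum]; rfl
  -- The restriction of each summand contains `χ`.
  have key {α β : Ghat → ℂ} (hα : IsRepChar Ghat α) (hβ : IsRepChar Ghat β)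
      (hαβ : indChar t χ = α + β) (hα0 : α ≠ 0) : charInner (α ∘ G.subtype) χ ≠ 0 := by
    intro h0
    have h1 : α ∘ G.subtype + β ∘ G.subtype = χ + χ := by rw [← hres, hαβ]; rfl
    have hαr : IsRepChar G (α ∘ G.subtype) := hα.comp G.subtype
    by_cases h3 : α ∘ G.subtype = 0
    · exact hα0 (hα.eq_zero_of_apply_one (congrFun h3 1))
    obtain ⟨φ, α', hφ, hα', h4⟩ := hαr.exists_eq_irr_add h3
    have h5 : charInner (χ + χ) φ ≠ 0 := by
      obtain ⟨m, hm⟩ := hα'.charInner_eq_natCast hφ.isRepChar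
      have hβr : IsRepChar G (β ∘ G.subtype) := hβ.comp G.subtype
      obtain ⟨n, hn⟩ := hβr.charInner_eq_natCast hφ.isRepChar
      rw [← h1, h4, charInner_add_left, charInner_add_left, hφ.charInner_self, hm, hn]
      norm_cast
      omega
    have h6 : χ = φ := hχ.eq_of_charInner_ne_zero hφ fun h => h5 (by
      rw [charInner_add_left, h, add_zero])
    obtain ⟨m, hm⟩ := hα'.charInner_eq_natCast hφ.isRepChar
    rw [h4, h6, charInner_add_left, hφ.charInner_self, hm] at h0
    norm_cast at h0
    omega
  have hθ0 : θ ≠ 0 := by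
    rintro rfl
    rw [hsum, add_zero, hψ.charInner_self] at hII
    norm_num at hII
  obtain ⟨α, hα, hψα⟩ := hψr.exists_eq_add_of_charInner_ne_zero hχ
    (key hψ.isRepChar hθ hsum hψ.ne_zero)
  obtain ⟨β, hβ, hθβ⟩ := hθr.exists_eq_add_of_charInner_ne_zero hχ
    (key hθ hψ.isRepChar (hsum.trans (add_comm _ _)) hθ0)
  have hαβ : α + β = 0 := by
    rw [hψα, hθβ] at hres'
    have h : (χ + χ) + (α + β) = χ + χ := (add_add_add_comm χ χ α β).trans hres'
    simpa using h
  have hα0 := hα.eq_zero_of_add_eq_zero hβ hαβ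
  have hβ0 := hβ.eq_zero_of_add_eq_zero hα ((add_comm _ _).trans hαβ)
  rw [hα0, add_zero] at hψα
  rw [hβ0, add_zero] at hθβ
  have hneg (x : Ghat) (hx : x ∉ G) : θ x = -ψ x := by
    have := congrFun hsum x
    rw [indChar_of_notMem h2 t χ hx, Pi.add_apply] at this
    exact (neg_eq_of_add_eq_zero_right this.symm).symm
  have heq (x : Ghat) (hx : x ∈ G) : θ x = ψ x :=
    congrFun (hθβ.trans hψα.symm) ⟨x, hx⟩
  have hθi : IsIrrChar Ghat θ := by
    refine isIrrChar_iff.2 ⟨hθ, ?_⟩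
    rw [← hψ.charInner_self]
    unfold charInner
    congr 1
    refine Finset.sum_congr rfl fun x _ => ?_
    by_cases hx : x ∈ G
    · rw [heq x hx, heq _ (G.inv_mem hx)]
    · rw [hneg x hx, hneg x⁻¹ (by simpa using hx), neg_mul_neg]
  refine ⟨ψ, θ, ?_, hψ, hθi, hψα, hθβ, hsum⟩
  rintro rfl
  have h1 := hψ.isRepChar.charInner_indChar h2 ht χ
  rw [hψα, hχ.charInner_self, hsum, charInner_add_right, hψ.charInner_self] at h1
  norm_num at h1

/-- An irreducible character of `Ghat` either restricts to an irreducible character of `G` or is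
induced from an irreducible character of `G` which is not invariant. -/
theorem IsIrrChar.extends_or_induced {ψ : Ghat → ℂ} (hψ : IsIrrChar Ghat ψ) (h2 : G.index = 2)
    {t : Ghat} (ht : t ∉ G) :
    IsIrrChar G (ψ ∘ G.subtype) ∨
      ∃ χ, IsIrrChar G χ ∧ _root_.bChar h2 t χ ≠ χ ∧ ψ = indChar t χ := by
  have hψr : IsRepChar G (ψ ∘ G.subtype) := hψ.isRepChar.comp G.subtype
  obtain ⟨χ, θ, hχ, hθ, hsum⟩ := hψr.exists_eq_irr_add fun h =>
    hψ.ne_zero (hψ.isRepChar.eq_zero_of_apply_one (congrFun h 1))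
  have hinner : charInner ψ (indChar t χ) ≠ 0 := by
    obtain ⟨m, hm⟩ := hθ.charInner_eq_natCast hχ.isRepChar
    rw [hψ.isRepChar.charInner_indChar h2 ht, hsum, charInner_add_left, hχ.charInner_self, hm]
    norm_cast
    omega
  by_cases hb : _root_.bChar h2 t χ = χ
  · left
    obtain ⟨ψ₁, ψ₂, -, h₁, h₂, hr₁, hr₂, hI⟩ := hχ.exists_extensions h2 ht hb
    rw [hI, charInner_add_right] at hinner
    by_cases h : charInner ψ ψ₁ = 0
    · rw [h, zero_add] at hinner
      rwa [hψ.eq_of_charInner_ne_zero h₂ hinner, hr₂]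
    · rwa [hψ.eq_of_charInner_ne_zero h₁ h, hr₁]
  · exact .inr ⟨χ, hχ, hb,
      hψ.eq_of_charInner_ne_zero (hχ.isIrrChar_indChar h2 ht hb) hinner⟩

end IndexTwo

/-! ### Indicators of a Real structure -/

section Indicators

theorem FS_eq_sum {G : Type} [Group G] [Fintype G] (χ : G → ℂ) :
    FS G χ = (Nat.card G : ℂ)⁻¹ * ∑ g, χ (g ^ 2) := by
  rw [FS, finsum_eq_sum_of_fintype, div_eq_inv_mul]

theorem IsIrrChar.FS_cases {G : Type} [Group G] [Fintype G] {χ : G → ℂ} (hχ : IsIrrChar G χ) :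
    (χ ≠ (fun g => χ g⁻¹) → FS G χ = 0) ∧
      (χ = (fun g => χ g⁻¹) → FS G χ = 1 ∨ FS G χ = -1) := by
  have h := hχ.twisted_indicator (MulEquiv.refl G) 1 (fun g => by simp) rfl
  simpa [FS_eq_sum, pow_two, Function.comp_def] using h

variable {Ghat : Type} [Group Ghat] {G : Subgroup Ghat} [Fintype Ghat] [Fintype G]

theorem FSsharp_eq_sum (h2 : G.index = 2) {t : Ghat} (ht : t ∉ G) (χ : G → ℂ) :
    FSsharp G h2 χ =
      (Nat.card G : ℂ)⁻¹ *
        ∑ g : G, χ ⟨(t * g) ^ 2, Subgroup.sq_mem_of_index_two h2 (t * g)⟩ := by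
  rw [FSsharp, div_eq_inv_mul, finsum_mem_def, finsum_eq_sum_of_fintype,
    sum_eq_sum_add_sum_of_index_two h2 ht]
  have h1 (g : G) : (g : Ghat) ∉ {g : Ghat | g ∉ G} := fun h => h g.2
  have h3 (g : G) : t * g ∈ {g : Ghat | g ∉ G} := fun h =>
    ht ((Subgroup.mul_mem_cancel_right G g.2).1 h)
  simp only [Set.indicator_of_notMem (h1 _), Set.indicator_of_mem (h3 _), Finset.sum_const_zero,
    zero_add]

theorem FS_add {G : Type} [Group G] [Fintype G] (χ φ : G → ℂ) :
    FS G (χ + φ) = FS G χ + FS G φ := by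
  simp only [FS_eq_sum, Pi.add_apply, Finset.sum_add_distrib, mul_add]

theorem FSsharp_add (h2 : G.index = 2) {t : Ghat} (ht : t ∉ G) (χ φ : G → ℂ) :
    FSsharp G h2 (χ + φ) = FSsharp G h2 χ + FSsharp G h2 φ := by
  simp only [FSsharp_eq_sum h2 ht, Pi.add_apply, Finset.sum_add_distrib, mul_add]

theorem FS_bChar (h2 : G.index = 2) (t : Ghat) (χ : G → ℂ) :
    FS G (bChar h2 t χ) = FS G χ := by
  have := Subgroup.normal_of_index_eq_two h2
  rw [FS_eq_sum, FS_eq_sum, bChar_eq_comp]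
  congr 1
  exact Fintype.sum_equiv (MulAut.conjNormal t : G ≃* G).toEquiv _ _ fun g => by
    simp only [Function.comp_apply, map_pow]; rfl

theorem FSsharp_bChar (h2 : G.index = 2) {t : Ghat} (ht : t ∉ G) (χ : G → ℂ) :
    FSsharp G h2 (bChar h2 t χ) = FSsharp G h2 χ := by
  have := Subgroup.normal_of_index_eq_two h2
  rw [FSsharp_eq_sum h2 ht, FSsharp_eq_sum h2 ht]
  congr 1
  refine Fintype.sum_equiv (MulAut.conjNormal t : G ≃* G).toEquiv _ _ fun g => ?_
  refine congrArg χ (Subtype.ext ?_)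
  change t * (t * g) ^ 2 * t⁻¹ = (t * (t * g * t⁻¹)) ^ 2
  rw [← conj_pow]
  simp only [mul_assoc]

theorem FS_eq_half (h2 : G.index = 2) {t : Ghat} (ht : t ∉ G) (ψ : Ghat → ℂ) :
    FS Ghat ψ = 2⁻¹ * (FS G (ψ ∘ G.subtype) + FSsharp G h2 (ψ ∘ G.subtype)) := by
  rw [FS_eq_sum, FS_eq_sum, FSsharp_eq_sum h2 ht, sum_eq_sum_add_sum_of_index_two h2 ht,
    card_eq_two_mul_of_index_two h2, mul_inv, mul_assoc, ← mul_add]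
  rfl

theorem IsIrrChar.FSsharp_cases {χ : G → ℂ} (hχ : IsIrrChar G χ) (h2 : G.index = 2) {t : Ghat}
    (ht : t ∉ G) :
    (_root_.bChar h2 t χ ≠ (fun g => χ g⁻¹) → FSsharp G h2 χ = 0) ∧
      (_root_.bChar h2 t χ = (fun g => χ g⁻¹) → FSsharp G h2 χ = 1 ∨ FSsharp G h2 χ = -1) := by
  have := Subgroup.normal_of_index_eq_two h2
  have h := hχ.twisted_indicator (MulAut.conjNormal t)
    ⟨t ^ 2, Subgroup.sq_mem_of_index_two h2 t⟩
    (fun g => Subtype.ext <| by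
      simp only [MulAut.conjNormal_apply, Subgroup.coe_mul, Subgroup.coe_inv, pow_two,
        mul_inv_rev, mul_assoc])
    (Subtype.ext <| by simp [pow_two, mul_assoc])
  have hs : FSsharp G h2 χ = (Nat.card G : ℂ)⁻¹ * ∑ g, χ (MulAut.conjNormal t g *
      ⟨t ^ 2, Subgroup.sq_mem_of_index_two h2 t⟩ * g) := by
    rw [FSsharp_eq_sum h2 ht]
    congr 1
    refine Finset.sum_congr rfl fun g _ => congrArg χ (Subtype.ext ?_)
    simp [pow_two, mul_assoc]
  rw [hs]
  exact h

theorem Set.ncard_eq_two_mul_ncard {α β : Type*} {s : Set α} {u : Set β} (f : α → β)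
    (hs : s.Finite) (hu : u.Finite) (hf : Set.MapsTo f s u)
    (hfib : ∀ y ∈ u, ∃ a b, a ≠ b ∧ {x ∈ s | f x = y} = {a, b}) :
    s.ncard = 2 * u.ncard := by
  rw [Set.ncard_eq_toFinset_card s hs, Set.ncard_eq_toFinset_card u hu,
    Finset.card_eq_sum_card_fiberwise (f := f) (t := hu.toFinset) (by simpa using hf),
    Finset.sum_const_nat (m := 2), mul_comm]
  intro y hy
  obtain ⟨a, b, hab, h⟩ := hfib y (by simpa using hy)
  rw [← Finset.card_pair hab]
  congr 1
  ext x
  simpa using Set.ext_iff.1 h x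

/-- The irreducible characters of `Ghat` of indicator `-1` with irreducible restriction. -/
theorem ncard_extending_eq (h2 : G.index = 2) {t : Ghat} (ht : t ∉ G) :
    Set.ncard {ψ : Ghat → ℂ | (IsIrrChar Ghat ψ ∧ FS Ghat ψ = -1) ∧
        IsIrrChar G (ψ ∘ G.subtype)} =
      2 * Set.ncard {χ : G → ℂ | IsIrrChar G χ ∧ FS G χ = -1 ∧ FSsharp G h2 χ = -1} := by
  refine Set.ncard_eq_two_mul_ncard (· ∘ G.subtype)
    (finite_setOf_isIrrChar.subset fun ψ h => h.1.1) (finite_setOf_isIrrChar.subset fun χ h => h.1)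
    ?_ ?_
  · rintro ψ ⟨⟨hψ, hF⟩, hr⟩
    refine ⟨hr, ?_⟩
    rw [FS_eq_half h2 ht] at hF
    have h1 := hr.FS_cases
    have h3 := hr.FSsharp_cases h2 ht
    generalize FS G (ψ ∘ G.subtype) = a at *
    generalize FSsharp G h2 (ψ ∘ G.subtype) = b at *
    have ha : a = 0 ∨ a = 1 ∨ a = -1 := by tauto
    have hb : b = 0 ∨ b = 1 ∨ b = -1 := by tauto
    rcases ha with rfl | rfl | rfl <;> rcases hb with rfl | rfl | rfl <;>
      first | (norm_num at hF; done) | norm_num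
  · rintro χ ⟨hχ, hF, hFs⟩
    have hdual : χ = (fun g => χ g⁻¹) := by
      by_contra h
      rw [hχ.FS_cases.1 h] at hF
      norm_num at hF
    have hb : bChar h2 t χ = χ := by
      by_contra h
      rw [(hχ.FSsharp_cases h2 ht).1 (by rwa [← hdual])] at hFs
      norm_num at hFs
    obtain ⟨ψ₁, ψ₂, hne, h₁, h₂, hr₁, hr₂, hI⟩ := hχ.exists_extensions h2 ht hb
    refine ⟨ψ₁, ψ₂, hne, Set.ext fun ψ => ⟨?_, ?_⟩⟩
    · rintro ⟨⟨⟨hψ, -⟩, -⟩, hr⟩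
      by_contra hmem
      rw [Set.mem_insert_iff, Set.mem_singleton_iff, not_or] at hmem
      have h := hψ.isRepChar.charInner_indChar h2 ht χ
      rw [show ψ ∘ G.subtype = χ from hr, hχ.charInner_self, hI, charInner_add_right,
        hψ.charInner_eq_zero h₁ hmem.1, hψ.charInner_eq_zero h₂ hmem.2] at h
      norm_num at h
    · have hF' {ψ : Ghat → ℂ} (hr : ψ ∘ G.subtype = χ) : FS Ghat ψ = -1 := by
        rw [FS_eq_half h2 ht, hr, hF, hFs]
        norm_num
      rintro (rfl | rfl)
      · exact ⟨⟨⟨h₁, hF' hr₁⟩, hr₁ ▸ hχ⟩, hr₁⟩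
      · exact ⟨⟨⟨h₂, hF' hr₂⟩, hr₂ ▸ hχ⟩, hr₂⟩

/-- The irreducible characters of `Ghat` of indicator `-1` with reducible restriction are induced,
each from exactly two characters. -/
theorem two_mul_ncard_induced_eq (h2 : G.index = 2) {t : Ghat} (ht : t ∉ G) :
    Set.ncard ({χ : G → ℂ | IsIrrChar G χ ∧ FS G χ = 0 ∧ FSsharp G h2 χ = -1} ∪
        {χ : G → ℂ | IsIrrChar G χ ∧ FS G χ = -1 ∧ FSsharp G h2 χ = 0}) =
      2 * Set.ncard {ψ : Ghat → ℂ | (IsIrrChar Ghat ψ ∧ FS Ghat ψ = -1) ∧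
        ¬IsIrrChar G (ψ ∘ G.subtype)} := by
  have hFS (χ : G → ℂ) : FS Ghat (indChar t χ) = FS G χ + FSsharp G h2 χ := by
    rw [FS_eq_half h2 ht, indChar_comp_subtype h2, FS_add, FSsharp_add h2 ht, FS_bChar,
      FSsharp_bChar h2 ht]
    ring
  have hmoved {χ : G → ℂ} (hχ : IsIrrChar G χ)
      (h : FS G χ = 0 ∧ FSsharp G h2 χ = -1 ∨ FS G χ = -1 ∧ FSsharp G h2 χ = 0) :
      bChar h2 t χ ≠ χ := by
    intro hb
    have h1 := hχ.FS_cases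
    have h3 := hχ.FSsharp_cases h2 ht
    rw [hb] at h3
    by_cases hd : χ = fun g => χ g⁻¹
    · rcases h with ⟨h, -⟩ | ⟨-, h⟩
      · have := h1.2 hd
        rw [h] at this
        norm_num at this
      · have := h3.2 hd
        rw [h] at this
        norm_num at this
    · rcases h with ⟨-, h⟩ | ⟨h, -⟩
      · rw [h3.1 hd] at h
        norm_num at h
      · rw [h1.1 hd] at h
        norm_num at h
  have hred {χ : G → ℂ} (hχ : IsIrrChar G χ) (hb : bChar h2 t χ ≠ χ) :
      ¬IsIrrChar G (indChar t χ ∘ G.subtype) := by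
    intro h
    have h1 := h.charInner_self
    have h3 := (hχ.bChar h2 t).charInner_eq_zero hχ hb
    rw [indChar_comp_subtype h2, charInner_add_left, charInner_add_right, charInner_add_right,
      hχ.charInner_self, (hχ.bChar h2 t).charInner_self, h3, charInner_comm, h3] at h1
    norm_num at h1
  refine Set.ncard_eq_two_mul_ncard (indChar t)
    (finite_setOf_isIrrChar.subset fun χ h => h.elim (·.1) (·.1))
    (finite_setOf_isIrrChar.subset fun ψ h => h.1.1) ?_ ?_
  · intro χ h
    rw [← Set.ofPred_or, Set.mem_ofPred_eq, ← and_or_left] at h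
    obtain ⟨hχ, h⟩ := h
    have hb := hmoved hχ h
    refine ⟨⟨hχ.isIrrChar_indChar h2 ht hb, ?_⟩, hred hχ hb⟩
    rw [hFS]
    rcases h with ⟨h, h'⟩ | ⟨h, h'⟩ <;> rw [h, h'] <;> norm_num
  · rintro ψ ⟨⟨hψ, hF⟩, hr⟩
    obtain ⟨χ, hχ, hb, rfl⟩ := (hψ.extends_or_induced h2 ht).resolve_left hr
    have hsum : FS G χ = 0 ∧ FSsharp G h2 χ = -1 ∨ FS G χ = -1 ∧ FSsharp G h2 χ = 0 := by
      rw [hFS] at hF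
      have h1 := hχ.FS_cases
      have h3 := hχ.FSsharp_cases h2 ht
      generalize FS G χ = a at *
      generalize FSsharp G h2 χ = b at *
      have ha : a = 0 ∨ a = 1 ∨ a = -1 := by tauto
      have hb : b = 0 ∨ b = 1 ∨ b = -1 := by tauto
      rcases ha with rfl | rfl | rfl <;> rcases hb with rfl | rfl | rfl <;>
      first | (norm_num at hF; done) | norm_num
    refine ⟨χ, bChar h2 t χ, hb.symm, Set.ext fun φ => ?_⟩
    rw [← Set.ofPred_or]
    simp only [Set.mem_ofPred_eq, ← and_or_left]
    constructor
    · rintro ⟨⟨hφ, -⟩, h⟩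
      by_contra hmem
      rw [Set.mem_insert_iff, Set.mem_singleton_iff, not_or] at hmem
      have h1 := congrArg (charInner φ <| · ∘ G.subtype) h
      simp only [indChar_comp_subtype h2, charInner_add_right, hφ.charInner_self,
        hφ.charInner_eq_zero hχ hmem.1, hφ.charInner_eq_zero (hχ.bChar h2 t) hmem.2] at h1
      obtain ⟨n, hn⟩ := hφ.isRepChar.charInner_eq_natCast (hφ.bChar h2 t).isRepChar
      rw [hn] at h1
      norm_cast at h1
      omega
    · rintro (rfl | rfl)
      · exact ⟨⟨hχ, hsum⟩, rfl⟩
      · refine ⟨⟨hχ.bChar h2 t, ?_⟩, hχ.isRepChar.indChar_bChar h2 t⟩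
        rwa [FS_bChar, FSsharp_bChar h2 ht]

end Indicators

/-- `N_VI + 4·N_VIII + N_X = 2·N̂_ℍ`. -/
theorem NVI_add_four_NVIII_add_NX {Ghat : Type} [Group Ghat] [Finite Ghat] (G : Subgroup Ghat)
    (h2 : G.index = 2) :
    Set.ncard {χ : ↥G → ℂ | IsIrrChar ↥G χ ∧ FS ↥G χ = 0 ∧ FSsharp G h2 χ = -1} +
      4 * Set.ncard {χ : ↥G → ℂ | IsIrrChar ↥G χ ∧ FS ↥G χ = -1 ∧ FSsharp G h2 χ = -1} +
      Set.ncard {χ : ↥G → ℂ | IsIrrChar ↥G χ ∧ FS ↥G χ = -1 ∧ FSsharp G h2 χ = 0} =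
    2 * Set.ncard {ψ : Ghat → ℂ | IsIrrChar Ghat ψ ∧ FS Ghat ψ = -1} := by
  have := Fintype.ofFinite Ghat
  have := Fintype.ofFinite G
  obtain ⟨t, ht⟩ : ∃ t, t ∉ G := by
    by_contra! h
    rw [(Subgroup.eq_top_iff' G).2 h, Subgroup.index_top] at h2
    norm_num at h2
  have hA := ncard_extending_eq h2 ht
  have hB := two_mul_ncard_induced_eq h2 ht
  have hdisj : Disjoint {χ : G → ℂ | IsIrrChar G χ ∧ FS G χ = 0 ∧ FSsharp G h2 χ = -1}
      {χ : G → ℂ | IsIrrChar G χ ∧ FS G χ = -1 ∧ FSsharp G h2 χ = 0} := by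
    refine Set.disjoint_left.2 fun χ h h' => ?_
    have := h.2.1.symm.trans h'.2.1
    norm_num at this
  rw [Set.ncard_union_eq hdisj (finite_setOf_isIrrChar.subset fun χ h => h.1)
    (finite_setOf_isIrrChar.subset fun χ h => h.1)] at hB
  have hS := Set.ncard_inter_add_ncard_sdiff_eq_ncard
    {ψ : Ghat → ℂ | IsIrrChar Ghat ψ ∧ FS Ghat ψ = -1}
    {ψ : Ghat → ℂ | IsIrrChar G (ψ ∘ G.subtype)}
    (finite_setOf_isIrrChar.subset fun ψ h => h.1)
  change Set.ncard {ψ : Ghat → ℂ | (IsIrrChar Ghat ψ ∧ FS Ghat ψ = -1) ∧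
      IsIrrChar G (ψ ∘ G.subtype)} + Set.ncard {ψ : Ghat → ℂ |
      (IsIrrChar Ghat ψ ∧ FS Ghat ψ = -1) ∧ ¬IsIrrChar G (ψ ∘ G.subtype)} = _ at hS
  omega
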